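/- Under the hypotheses of the energy dissipation law for the periodic multi-phase hydrodynamic system (smooth ℤ²-periodic solution (u, p, φ, ψ) on [0,T] of ρ(u_t + u·∇u) + ∇p = λ∇·σ̃ᵉ + μΔu, ∇·u = 0, φ_t + u·∇φ = −M₁ δE/δφ, ψ_t + u·∇ψ = −M₂ δE/δψ, with positive constants ρ, μ, λ, M₁, M₂, γ₁, γ₂, ε₁, ε₂), the total energy 𝓔(t) = ∫_Q ( (ρ/2)|u|² + λ W ) dx is nonincreasing on [0,T]: for all 0 ≤ s ≤ t ≤ T one has 𝓔(t) ≤ 𝓔(s). -/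

import Mathlib

open MeasureTheory

/-- Partial derivative in the `i`-th coordinate direction. -/
noncomputable def pd (i : Fin 2) (f : (Fin 2 → ℝ) → ℝ) (x : Fin 2 → ℝ) : ℝ :=
  fderiv ℝ f x (Pi.single i 1)

/-- The periodic unit cell `Q = [0,1)²`. -/
def Q : Set (Fin 2 → ℝ) := Set.univ.pi fun _ => Set.Ico (0 : ℝ) 1

/-- The mixing energy density
`W = γ₁((ψ−1)/2)²((ε₁/2)|∇φ|² + (1/(4ε₁))(φ²−1)²) + γ₂((ε₂/2)|∇ψ|² + (1/(4ε₂))(ψ²−1)²)`. -/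
noncomputable def W (γ1 γ2 ε1 ε2 : ℝ) (φ ψ : (Fin 2 → ℝ) → ℝ) (x : Fin 2 → ℝ) : ℝ :=
  γ1 * ((ψ x - 1) / 2) ^ 2 *
      ((ε1 / 2) * ∑ j, (pd j φ x) ^ 2 + (1 / (4 * ε1)) * ((φ x) ^ 2 - 1) ^ 2)
  + γ2 * ((ε2 / 2) * ∑ j, (pd j ψ x) ^ 2 + (1 / (4 * ε2)) * ((ψ x) ^ 2 - 1) ^ 2)

/-- Variational derivative `δE/δφ = −γ₁(ε₁ ∇·[((ψ−1)/2)²∇φ] − (1/ε₁)((ψ−1)/2)²(φ²−1)φ)`. -/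
noncomputable def dEdφ (γ1 ε1 : ℝ) (φ ψ : (Fin 2 → ℝ) → ℝ) (x : Fin 2 → ℝ) : ℝ :=
  -γ1 * (ε1 * (∑ j, pd j (fun y => ((ψ y - 1) / 2) ^ 2 * pd j φ y) x)
    - (1 / ε1) * ((ψ x - 1) / 2) ^ 2 * ((φ x) ^ 2 - 1) * φ x)

/-- Variational derivative
`δE/δψ = −γ₂(ε₂Δψ − (1/ε₂)(ψ²−1)ψ) + γ₁((ψ−1)/2)((ε₁/2)|∇φ|² + (1/(4ε₁))(φ²−1)²)`. -/
noncomputable def dEdψ (γ1 γ2 ε1 ε2 : ℝ) (φ ψ : (Fin 2 → ℝ) → ℝ) (x : Fin 2 → ℝ) : ℝ :=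
  -γ2 * (ε2 * (∑ j, pd j (fun y => pd j ψ y) x) - (1 / ε2) * ((ψ x) ^ 2 - 1) * ψ x)
  + γ1 * ((ψ x - 1) / 2) *
      ((ε1 / 2) * ∑ j, (pd j φ x) ^ 2 + (1 / (4 * ε1)) * ((φ x) ^ 2 - 1) ^ 2)

/-- The simplified elastic stress `σ̃ᵉ = −γ₁ε₁((ψ−1)/2)²∇φ⊗∇φ − γ₂ε₂∇ψ⊗∇ψ`. -/
noncomputable def sigmaE (γ1 γ2 ε1 ε2 : ℝ) (φ ψ : (Fin 2 → ℝ) → ℝ) (x : Fin 2 → ℝ)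
    (i j : Fin 2) : ℝ :=
  -(γ1 * ε1 * ((ψ x - 1) / 2) ^ 2 * pd i φ x * pd j φ x)
  - γ2 * ε2 * pd i ψ x * pd j ψ x

/-- Space-time. -/
abbrev XX := ℝ × (Fin 2 → ℝ)

/-- Directional derivative on space-time. -/
noncomputable def DD (v : XX) (F : XX → ℝ) (q : XX) : ℝ := fderiv ℝ F q v

/-- Smoothness. -/
abbrev Sm (F : XX → ℝ) : Prop := ContDiff ℝ (⊤ : ℕ∞) F

theorem Sm.dif {F : XX → ℝ} (h : ContDiff ℝ (⊤ : ℕ∞) F) : Differentiable ℝ F :=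
  h.differentiable (by simp)

@[fun_prop]
theorem DD_smooth (v : XX) (F : XX → ℝ) (h : ContDiff ℝ (⊤ : ℕ∞) F) :
    ContDiff ℝ (⊤ : ℕ∞) (DD v F) := by
  unfold DD
  exact (h.fderiv_right (m := (⊤ : ℕ∞)) (by simp)).clm_apply contDiff_const

theorem DD_mul (v : XX) (F G : XX → ℝ) (hF : ContDiff ℝ (⊤ : ℕ∞) F) (hG : ContDiff ℝ (⊤ : ℕ∞) G)
    (q : XX) : DD v (fun q => F q * G q) q = DD v F q * G q + F q * DD v G q := by
  unfold DD
  rw [fderiv_fun_mul (Sm.dif hF q) (Sm.dif hG q)]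
  simp
  ring

theorem DD_add (v : XX) (F G : XX → ℝ) (hF : ContDiff ℝ (⊤ : ℕ∞) F) (hG : ContDiff ℝ (⊤ : ℕ∞) G)
    (q : XX) : DD v (fun q => F q + G q) q = DD v F q + DD v G q := by
  unfold DD
  rw [fderiv_fun_add (Sm.dif hF q) (Sm.dif hG q)]
  simp

theorem DD_sub (v : XX) (F G : XX → ℝ) (hF : ContDiff ℝ (⊤ : ℕ∞) F) (hG : ContDiff ℝ (⊤ : ℕ∞) G)
    (q : XX) : DD v (fun q => F q - G q) q = DD v F q - DD v G q := by
  unfold DD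
  rw [fderiv_fun_sub (Sm.dif hF q) (Sm.dif hG q)]
  simp

theorem DD_neg (v : XX) (F : XX → ℝ) (q : XX) : DD v (fun q => - F q) q = - DD v F q := by
  unfold DD
  rw [fderiv_fun_neg]
  simp

theorem DD_const (v : XX) (c : ℝ) (q : XX) : DD v (fun _ => c) q = 0 := by
  unfold DD
  simp

theorem DD_div (v : XX) (F : XX → ℝ) (c : ℝ) (hF : ContDiff ℝ (⊤ : ℕ∞) F) 
    (q : XX) : DD v (fun q => F q / c) q = DD v F q / c := by
  simp only [div_eq_mul_inv]
  rw [DD_mul v F (fun _ => c⁻¹) hF (by fun_prop), DD_const]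
  ring

theorem DD_sq (v : XX) (F : XX → ℝ) (hF : ContDiff ℝ (⊤ : ℕ∞) F)
    (q : XX) : DD v (fun q => F q ^ 2) q = 2 * F q * DD v F q := by
  simp only [pow_two]
  rw [DD_mul v F F hF hF]
  ring

theorem DD_comm (v w : XX) (F : XX → ℝ) (hF : ContDiff ℝ (⊤ : ℕ∞) F) (q : XX) :
    DD v (DD w F) q = DD w (DD v F) q := by
  have h1 : Differentiable ℝ (fderiv ℝ F) :=
    (hF.fderiv_right (m := (⊤ : ℕ∞)) (by simp)).differentiable (by simp)
  have key : ∀ a b : XX, DD a (DD b F) q = fderiv ℝ (fderiv ℝ F) q a b := by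
    intro a b
    unfold DD
    rw [fderiv_clm_apply (h1 q) (by fun_prop)]
    simp
  rw [key, key]
  exact (hF.contDiffAt.isSymmSndFDerivAt (by simp; exact WithTop.coe_le_coe.2 (le_top : (2 : ℕ∞) ≤ ⊤))) v w

theorem DD_per (v c : XX) (F : XX → ℝ) (h : ∀ q, F (q + c) = F q) (q : XX) :
    DD v F (q + c) = DD v F q := by
  unfold DD
  rw [← fderiv_comp_add_right c]
  simp [h]

theorem pd_eq (j : Fin 2) (F : XX → ℝ) (hF : ContDiff ℝ (⊤ : ℕ∞) F) (t : ℝ) (x : Fin 2 → ℝ) :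
    pd j (fun y => F (t, y)) x = DD (0, Pi.single j 1) F (t, x) := by
  unfold pd DD
  have h : HasFDerivAt (fun y : Fin 2 → ℝ => F (t, y)) _ x :=
    ((Sm.dif hF (t, x)).hasFDerivAt).comp x (hasFDerivAt_prodMk_right t x)
  rw [h.fderiv]
  simp

theorem dt_hasDeriv (F : XX → ℝ) (hF : ContDiff ℝ (⊤ : ℕ∞) F) (t : ℝ) (x : Fin 2 → ℝ) :
    HasDerivAt (fun s => F (s, x)) (DD (1, 0) F (t, x)) t := by
  have h : HasFDerivAt (fun s : ℝ => F (s, x)) _ t :=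
    ((Sm.dif hF (t, x)).hasFDerivAt).comp t (hasFDerivAt_prodMk_left t x)
  have := h.hasDerivAt
  simpa [DD] using this

theorem Q_ae : Q =ᵐ[volume] Set.Icc (0 : Fin 2 → ℝ) 1 := by
  have := Measure.univ_pi_Ico_ae_eq_Icc (μ := fun _ : Fin 2 => (volume : Measure ℝ))
    (f := (0 : Fin 2 → ℝ)) (g := 1)
  simpa [Q, volume_pi] using this

theorem int_Q (f : (Fin 2 → ℝ) → ℝ) : ∫ x in Q, f x = ∫ x in Set.Icc (0 : Fin 2 → ℝ) 1, f x :=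
  setIntegral_congr_set Q_ae

theorem int_div (G0 G1 : XX → ℝ) (h0 : ContDiff ℝ (⊤ : ℕ∞) G0) (h1 : ContDiff ℝ (⊤ : ℕ∞) G1)
    (p0 : ∀ q, G0 (q + (0, Pi.single 0 1)) = G0 q)
    (p1 : ∀ q, G1 (q + (0, Pi.single 1 1)) = G1 q) (t : ℝ) :
    ∫ x in Set.Icc (0 : Fin 2 → ℝ) 1, (DD (0, Pi.single 0 1) G0 (t, x)
      + DD (0, Pi.single 1 1) G1 (t, x)) = 0 := by
  have hG : ∀ i, ContDiff ℝ (⊤ : ℕ∞) ((![G0, G1] : Fin 2 → XX → ℝ) i) := by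
    intro i
    fin_cases i <;> simpa
  have hp : ∀ i q, (![G0, G1] : Fin 2 → XX → ℝ) i (q + (0, Pi.single i 1))
      = (![G0, G1] : Fin 2 → XX → ℝ) i q := by
    intro i
    fin_cases i
    · simpa using p0
    · simpa using p1
  have hdif : ∀ i (x : Fin 2 → ℝ), HasFDerivAt
      (fun y : Fin 2 → ℝ => (![G0, G1] : Fin 2 → XX → ℝ) i (t, y))
      ((fderiv ℝ ((![G0, G1] : Fin 2 → XX → ℝ) i) (t, x)).comp
        (ContinuousLinearMap.inr ℝ ℝ (Fin 2 → ℝ))) x := fun i x =>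
    ((Sm.dif (hG i) (t, x)).hasFDerivAt).comp x (hasFDerivAt_prodMk_right t x)
  have hc : ∀ i, Continuous (fun x : Fin 2 → ℝ => DD (0, Pi.single i 1)
      ((![G0, G1] : Fin 2 → XX → ℝ) i) (t, x)) := by
    intro i
    have := (DD_smooth (0, Pi.single i 1) _ (hG i)).continuous
    exact this.comp (by fun_prop)
  have key := integral_divergence_of_hasFDerivAt_off_countable' (n := 1) (E := ℝ)
    (0 : Fin 2 → ℝ) 1 (by intro i; simp)
    (fun i y => (![G0, G1] : Fin 2 → XX → ℝ) i (t, y))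
    (fun i x => (fderiv ℝ ((![G0, G1] : Fin 2 → XX → ℝ) i) (t, x)).comp
        (ContinuousLinearMap.inr ℝ ℝ (Fin 2 → ℝ))) ∅ Set.countable_empty
    (fun i => (((hG i).continuous).comp (by fun_prop)).continuousOn)
    (fun x _ i => hdif i x)
    (by
      apply ContinuousOn.integrableOn_Icc
      apply Continuous.continuousOn
      refine continuous_finsetSum _ fun i _ => ?_
      exact hc i)
  have hl : (∫ x in Set.Icc (0 : Fin 2 → ℝ) 1, (DD (0, Pi.single 0 1) G0 (t, x)
      + DD (0, Pi.single 1 1) G1 (t, x))) = ∫ x in Set.Icc (0 : Fin 2 → ℝ) 1, ∑ i : Fin 2,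
      ((fderiv ℝ ((![G0, G1] : Fin 2 → XX → ℝ) i) (t, x)).comp
        (ContinuousLinearMap.inr ℝ ℝ (Fin 2 → ℝ))) (Pi.single i 1) := by
    simp [Fin.sum_univ_two, DD]
  rw [hl]
  refine key.trans ?_
  apply Finset.sum_eq_zero
  intro i _
  rw [sub_eq_zero]
  congr 1
  funext x
  have := hp i (t, i.insertNth 0 x)
  rw [Pi.zero_apply, Pi.one_apply]
  convert this using 2
  ext k
  · simp
  · simp only [Prod.mk_add_mk, Pi.add_apply]
    refine Fin.succAboveCases i ?_ (fun k => ?_) k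
    · simp
    · simp [Fin.succAbove_ne]

theorem int_deriv (e : XX → ℝ) (he : ContDiff ℝ (⊤ : ℕ∞) e) (t : ℝ) :
    HasDerivAt (fun s => ∫ x in Set.Icc (0 : Fin 2 → ℝ) 1, e (s, x))
      (∫ x in Set.Icc (0 : Fin 2 → ℝ) 1, DD (1, 0) e (t, x)) t := by
  have hD := (DD_smooth (1, 0) e he).continuous
  obtain ⟨C, hC⟩ := ((isCompact_Icc (a := t - 1) (b := t + 1)).prod
    (isCompact_Icc (a := (0 : Fin 2 → ℝ)) (b := 1))).exists_bound_of_continuousOn hD.continuousOn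
  have hce : ∀ s, Continuous (fun x : Fin 2 → ℝ => e (s, x)) := fun s =>
    he.continuous.comp (by fun_prop)
  have hcd : ∀ s, Continuous (fun x : Fin 2 → ℝ => DD (1, 0) e (s, x)) := fun s =>
    hD.comp (by fun_prop)
  refine (hasDerivAt_integral_of_dominated_loc_of_deriv_le
    (F := fun s x => e (s, x)) (F' := fun s x => DD (1, 0) e (s, x))
    (bound := fun _ => C) (s := Set.Icc (t - 1) (t + 1)) 
    (Icc_mem_nhds (by linarith) (by linarith)) ?_ ?_ ?_ ?_ ?_ ?_).2
  · exact Filter.Eventually.of_forall fun s => (hce s).aestronglyMeasurable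
  · exact (hce t).continuousOn.integrableOn_Icc
  · exact (hcd t).aestronglyMeasurable
  · refine (ae_restrict_iff' measurableSet_Icc).2 (Filter.Eventually.of_forall ?_)
    intro x hx s hs
    exact hC (s, x) ⟨hs, hx⟩
  · exact continuousOn_const.integrableOn_Icc
  · exact Filter.Eventually.of_forall fun x s _ => dt_hasDeriv e he s x

/-- Abstract version: a local energy law with periodic flux implies monotonicity. -/
theorem mono_of_local (T : ℝ) (e d G0 G1 : XX → ℝ) (he : ContDiff ℝ (⊤ : ℕ∞) e)
    (h0 : ContDiff ℝ (⊤ : ℕ∞) G0) (h1 : ContDiff ℝ (⊤ : ℕ∞) G1)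
    (p0 : ∀ q, G0 (q + (0, Pi.single 0 1)) = G0 q)
    (p1 : ∀ q, G1 (q + (0, Pi.single 1 1)) = G1 q)
    (hd : ∀ q, d q ≤ 0)
    (hloc : ∀ t ∈ Set.Icc (0 : ℝ) T, ∀ x, DD (1, 0) e (t, x)
      = d (t, x) + (DD (0, Pi.single 0 1) G0 (t, x) + DD (0, Pi.single 1 1) G1 (t, x))) :
    ∀ s t : ℝ, 0 ≤ s → s ≤ t → t ≤ T →
      (∫ x in Q, e (t, x)) ≤ ∫ x in Q, e (s, x) := by
  intro s t hs hst ht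
  rw [int_Q, int_Q]
  have hanti : AntitoneOn (fun s => ∫ x in Set.Icc (0 : Fin 2 → ℝ) 1, e (s, x))
      (Set.Icc 0 T) := by
    apply antitoneOn_of_deriv_nonpos (convex_Icc 0 T)
    · exact fun r _ => (int_deriv e he r).continuousAt.continuousWithinAt
    · exact fun r _ => (int_deriv e he r).differentiableAt.differentiableWithinAt
    · intro r hr
      have hr' := interior_subset hr
      rw [(int_deriv e he r).deriv, ← int_div G0 G1 h0 h1 p0 p1 r]
      have c0 : ∀ (v : XX) (F : XX → ℝ), ContDiff ℝ (⊤ : ℕ∞) F →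
          Continuous (fun x : Fin 2 → ℝ => DD v F (r, x)) := fun v F hF =>
        (DD_smooth v F hF).continuous.comp (by fun_prop)
      apply setIntegral_mono
      · exact (c0 _ _ he).continuousOn.integrableOn_Icc
      · exact ((c0 _ _ h0).add (c0 _ _ h1)).continuousOn.integrableOn_Icc
      · intro x
        have := hloc r hr' x
        have := hd (r, x)
        dsimp only
        linarith
  exact hanti ⟨hs, hst.trans ht⟩ ⟨hs.trans hst, ht⟩ hst

set_option maxHeartbeats 4000000 in
/-- The pointwise (local) energy identity. -/
theorem local_id (ρ μ lam M1 M2 γ1 γ2 ε1 ε2 : ℝ) (et e0 e1 q : XX)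
    (U V P Φ Ψ : XX → ℝ)
    (hU : ContDiff ℝ (⊤ : ℕ∞) U) (hV : ContDiff ℝ (⊤ : ℕ∞) V) (hP : ContDiff ℝ (⊤ : ℕ∞) P)
    (hΦ : ContDiff ℝ (⊤ : ℕ∞) Φ) (hΨ : ContDiff ℝ (⊤ : ℕ∞) Ψ)
    (Eφ Eψ : ℝ)
    (hEφ : Eφ = -γ1 * (ε1 * (DD e0 (fun q => ((Ψ q - 1) / 2) ^ 2 * DD e0 Φ q) q
        + DD e1 (fun q => ((Ψ q - 1) / 2) ^ 2 * DD e1 Φ q) q)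
      - (1 / ε1) * ((Ψ q - 1) / 2) ^ 2 * ((Φ q) ^ 2 - 1) * Φ q))
    (hEψ : Eψ = -γ2 * (ε2 * (DD e0 (DD e0 Ψ) q + DD e1 (DD e1 Ψ) q)
        - (1 / ε2) * ((Ψ q) ^ 2 - 1) * Ψ q)
      + γ1 * ((Ψ q - 1) / 2) *
      ((ε1 / 2) * (DD e0 Φ q ^ 2 + DD e1 Φ q ^ 2) + (1 / (4 * ε1)) * ((Φ q) ^ 2 - 1) ^ 2))
    (hm0 : ρ * (DD et U q + (U q * DD e0 U q + V q * DD e1 U q)) + DD e0 P q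
      = lam * (DD e0 (fun q => -(γ1 * ε1 * ((Ψ q - 1) / 2) ^ 2 * DD e0 Φ q * DD e0 Φ q)
            - γ2 * ε2 * DD e0 Ψ q * DD e0 Ψ q) q
          + DD e1 (fun q => -(γ1 * ε1 * ((Ψ q - 1) / 2) ^ 2 * DD e0 Φ q * DD e1 Φ q)
            - γ2 * ε2 * DD e0 Ψ q * DD e1 Ψ q) q)
        + μ * (DD e0 (DD e0 U) q + DD e1 (DD e1 U) q))
    (hm1 : ρ * (DD et V q + (U q * DD e0 V q + V q * DD e1 V q)) + DD e1 P q
      = lam * (DD e0 (fun q => -(γ1 * ε1 * ((Ψ q - 1) / 2) ^ 2 * DD e1 Φ q * DD e0 Φ q)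
            - γ2 * ε2 * DD e1 Ψ q * DD e0 Ψ q) q
          + DD e1 (fun q => -(γ1 * ε1 * ((Ψ q - 1) / 2) ^ 2 * DD e1 Φ q * DD e1 Φ q)
            - γ2 * ε2 * DD e1 Ψ q * DD e1 Ψ q) q)
        + μ * (DD e0 (DD e0 V) q + DD e1 (DD e1 V) q))
    (hd : DD e0 U q + DD e1 V q = 0)
    (hφ : DD et Φ q + (U q * DD e0 Φ q + V q * DD e1 Φ q) = -M1 * Eφ)
    (hψ : DD et Ψ q + (U q * DD e0 Ψ q + V q * DD e1 Ψ q) = -M2 * Eψ)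
    (e : XX → ℝ) (he : e = fun q => (ρ / 2) * (U q ^ 2 + V q ^ 2) + lam *
      (γ1 * ((Ψ q - 1) / 2) ^ 2 *
      ((ε1 / 2) * (DD e0 Φ q ^ 2 + DD e1 Φ q ^ 2) + (1 / (4 * ε1)) * ((Φ q) ^ 2 - 1) ^ 2)
      + γ2 * ((ε2 / 2) * (DD e0 Ψ q ^ 2 + DD e1 Ψ q ^ 2)
        + (1 / (4 * ε2)) * ((Ψ q) ^ 2 - 1) ^ 2))) :
    DD et e q = (-(lam * M1) * Eφ ^ 2 - lam * M2 * Eψ ^ 2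
        - μ * (DD e0 U q ^ 2 + DD e1 U q ^ 2 + DD e0 V q ^ 2 + DD e1 V q ^ 2))
      + (DD e0 (fun q => lam * (γ1 * ε1 * ((Ψ q - 1) / 2) ^ 2 * DD e0 Φ q * DD et Φ q
            + γ2 * ε2 * DD e0 Ψ q * DD et Ψ q)
          - U q * (P q + e q) + μ * (U q * DD e0 U q + V q * DD e0 V q)) q
        + DD e1 (fun q => lam * (γ1 * ε1 * ((Ψ q - 1) / 2) ^ 2 * DD e1 Φ q * DD et Φ q
            + γ2 * ε2 * DD e1 Ψ q * DD et Ψ q)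
          - V q * (P q + e q) + μ * (U q * DD e1 U q + V q * DD e1 V q)) q) := by
  have hes : ContDiff ℝ (⊤ : ℕ∞) e := by
    rw [he]; fun_prop
  have hev : ∀ v, DD v e q = ρ * (U q * DD v U q + V q * DD v V q) + lam *
      (γ1 * ((Ψ q - 1) / 2) * DD v Ψ q *
      ((ε1 / 2) * (DD e0 Φ q ^ 2 + DD e1 Φ q ^ 2) + (1 / (4 * ε1)) * ((Φ q) ^ 2 - 1) ^ 2)
      + γ1 * ((Ψ q - 1) / 2) ^ 2 * (ε1 * (DD e0 Φ q * DD v (DD e0 Φ) q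
        + DD e1 Φ q * DD v (DD e1 Φ) q) + (1 / ε1) * ((Φ q) ^ 2 - 1) * Φ q * DD v Φ q)
      + γ2 * (ε2 * (DD e0 Ψ q * DD v (DD e0 Ψ) q
        + DD e1 Ψ q * DD v (DD e1 Ψ) q) + (1 / ε2) * ((Ψ q) ^ 2 - 1) * Ψ q * DD v Ψ q)) := by
    intro v
    rw [he]
    simp (disch := fun_prop) only [DD_add, DD_sub, DD_mul, DD_neg, DD_const, DD_div, DD_sq]
    ring
  simp (disch := fun_prop) only [DD_add, DD_sub, DD_mul, DD_neg, DD_const, DD_div, DD_sq]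
    at hm0 hm1 hEφ ⊢
  rw [hev et, hev e0, hev e1]
  rw [DD_comm e1 e0 Φ hΦ, DD_comm et e0 Φ hΦ, DD_comm et e1 Φ hΦ,
    DD_comm e1 e0 Ψ hΨ, DD_comm et e0 Ψ hΨ, DD_comm et e1 Ψ hΨ]
  rw [DD_comm e1 e0 Φ hΦ, DD_comm e1 e0 Ψ hΨ] at hm0
  generalize e q = e' at *
  linear_combination U q * hm0 + V q * hm1 + lam * Eφ * hφ + lam * Eψ * hψ
    + (P q + e') * hd - lam * (DD et Φ q + (U q * DD e0 Φ q + V q * DD e1 Φ q)) * hEφ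
    - lam * (DD et Ψ q + (U q * DD e0 Ψ q + V q * DD e1 Ψ q)) * hEψ

/-- The total energy `𝓔(t) = ∫_Q ((ρ/2)|u|² + λW) dx` of the periodic multi-phase
hydrodynamic system is nonincreasing on `[0,T]`. -/
theorem stmt6
    (T ρ μ lam M1 M2 γ1 γ2 ε1 ε2 : ℝ)
    (hT : 0 < T) (hρ : 0 < ρ) (hμ : 0 < μ) (hlam : 0 < lam)
    (hM1 : 0 < M1) (hM2 : 0 < M2)
    (hγ1 : 0 < γ1) (hγ2 : 0 < γ2) (hε1 : 0 < ε1) (hε2 : 0 < ε2)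
    (u : ℝ → (Fin 2 → ℝ) → Fin 2 → ℝ) (p φ ψ : ℝ → (Fin 2 → ℝ) → ℝ)
    (hu : ContDiff ℝ (⊤ : ℕ∞) (fun q : ℝ × (Fin 2 → ℝ) => u q.1 q.2))
    (hp : ContDiff ℝ (⊤ : ℕ∞) (fun q : ℝ × (Fin 2 → ℝ) => p q.1 q.2))
    (hφ : ContDiff ℝ (⊤ : ℕ∞) (fun q : ℝ × (Fin 2 → ℝ) => φ q.1 q.2))
    (hψ : ContDiff ℝ (⊤ : ℕ∞) (fun q : ℝ × (Fin 2 → ℝ) => ψ q.1 q.2))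
    (huper : ∀ (t : ℝ) (x : Fin 2 → ℝ) (m : Fin 2 → ℤ),
      u t (x + fun i => (m i : ℝ)) = u t x)
    (hpper : ∀ (t : ℝ) (x : Fin 2 → ℝ) (m : Fin 2 → ℤ),
      p t (x + fun i => (m i : ℝ)) = p t x)
    (hφper : ∀ (t : ℝ) (x : Fin 2 → ℝ) (m : Fin 2 → ℤ),
      φ t (x + fun i => (m i : ℝ)) = φ t x)
    (hψper : ∀ (t : ℝ) (x : Fin 2 → ℝ) (m : Fin 2 → ℤ),
      ψ t (x + fun i => (m i : ℝ)) = ψ t x)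
    -- momentum equation: ρ(u_t + u·∇u) + ∇p = λ∇·σ̃ᵉ + μΔu
    (hmom : ∀ t ∈ Set.Icc (0 : ℝ) T, ∀ (x : Fin 2 → ℝ) (i : Fin 2),
      ρ * (deriv (fun s => u s x i) t + ∑ j, u t x j * pd j (fun y => u t y i) x)
          + pd i (p t) x
        = lam * (∑ j, pd j (fun y => sigmaE γ1 γ2 ε1 ε2 (φ t) (ψ t) y i j) x)
          + μ * ∑ j, pd j (fun y => pd j (fun z => u t z i) y) x)
    -- incompressibility: ∇·u = 0
    (hdiv : ∀ t ∈ Set.Icc (0 : ℝ) T, ∀ x : Fin 2 → ℝ,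
      ∑ j, pd j (fun y => u t y j) x = 0)
    -- phase field equations
    (hφeq : ∀ t ∈ Set.Icc (0 : ℝ) T, ∀ x : Fin 2 → ℝ,
      deriv (fun s => φ s x) t + ∑ j, u t x j * pd j (φ t) x
        = -M1 * dEdφ γ1 ε1 (φ t) (ψ t) x)
    (hψeq : ∀ t ∈ Set.Icc (0 : ℝ) T, ∀ x : Fin 2 → ℝ,
      deriv (fun s => ψ s x) t + ∑ j, u t x j * pd j (ψ t) x
        = -M2 * dEdψ γ1 γ2 ε1 ε2 (φ t) (ψ t) x) :
    ∀ s t : ℝ, 0 ≤ s → s ≤ t → t ≤ T →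
      (∫ x in Q, ((ρ / 2) * ∑ i, (u t x i) ^ 2 + lam * W γ1 γ2 ε1 ε2 (φ t) (ψ t) x))
        ≤ ∫ x in Q, ((ρ / 2) * ∑ i, (u s x i) ^ 2 + lam * W γ1 γ2 ε1 ε2 (φ s) (ψ s) x) := by
  have hU : ∀ i, ContDiff ℝ (⊤ : ℕ∞) (fun q : XX => u q.1 q.2 i) := fun i =>
    (contDiff_pi.1 hu) i
  obtain ⟨U, rU⟩ : ∃ U : XX → ℝ, U = fun q => u q.1 q.2 0 := ⟨_, rfl⟩
  obtain ⟨V, rV⟩ : ∃ V : XX → ℝ, V = fun q => u q.1 q.2 1 := ⟨_, rfl⟩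
  obtain ⟨P, rP⟩ : ∃ P : XX → ℝ, P = fun q => p q.1 q.2 := ⟨_, rfl⟩
  obtain ⟨Φ, rΦ⟩ : ∃ Φ : XX → ℝ, Φ = fun q => φ q.1 q.2 := ⟨_, rfl⟩
  obtain ⟨Ψ, rΨ⟩ : ∃ Ψ : XX → ℝ, Ψ = fun q => ψ q.1 q.2 := ⟨_, rfl⟩
  have sU : ContDiff ℝ (⊤ : ℕ∞) U := by rw [rU]; exact hU 0
  have sV : ContDiff ℝ (⊤ : ℕ∞) V := by rw [rV]; exact hU 1
  have sP : ContDiff ℝ (⊤ : ℕ∞) P := by rw [rP]; exact hp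
  have sΦ : ContDiff ℝ (⊤ : ℕ∞) Φ := by rw [rΦ]; exact hφ
  have sΨ : ContDiff ℝ (⊤ : ℕ∞) Ψ := by rw [rΨ]; exact hψ
  have eU : ∀ t x, u t x 0 = U (t, x) := by intro t x; rw [rU]
  have eV : ∀ t x, u t x 1 = V (t, x) := by intro t x; rw [rV]
  have eP : ∀ t, p t = fun x => P (t, x) := by intro t; rw [rP]
  have eΦ : ∀ t, φ t = fun x => Φ (t, x) := by intro t; rw [rΦ]
  have eΨ : ∀ t, ψ t = fun x => Ψ (t, x) := by intro t; rw [rΨ]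
  have hm : ∀ j : Fin 2, (fun i => (((Pi.single j 1 : Fin 2 → ℤ) i : ℤ) : ℝ))
      = (Pi.single j 1 : Fin 2 → ℝ) := by
    intro j
    funext i
    by_cases h : i = j
    · subst h; simp
    · simp [h]
  have pU : ∀ (j : Fin 2) q, U (q + (0, Pi.single j 1)) = U q := by
    intro j q
    have := huper q.1 q.2 (Pi.single j 1)
    rw [hm] at this
    simp [rU, this]
  have pV : ∀ (j : Fin 2) q, V (q + (0, Pi.single j 1)) = V q := by
    intro j q
    have := huper q.1 q.2 (Pi.single j 1)
    rw [hm] at this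
    simp [rV, this]
  have pP : ∀ (j : Fin 2) q, P (q + (0, Pi.single j 1)) = P q := by
    intro j q
    have := hpper q.1 q.2 (Pi.single j 1)
    rw [hm] at this
    simp [rP, this]
  have pΦ : ∀ (j : Fin 2) q, Φ (q + (0, Pi.single j 1)) = Φ q := by
    intro j q
    have := hφper q.1 q.2 (Pi.single j 1)
    rw [hm] at this
    simp [rΦ, this]
  have pΨ : ∀ (j : Fin 2) q, Ψ (q + (0, Pi.single j 1)) = Ψ q := by
    intro j q
    have := hψper q.1 q.2 (Pi.single j 1)
    rw [hm] at this
    simp [rΨ, this]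
  clear rU rV rP rΦ rΨ hU hu hp hφ hψ huper hpper hφper hψper
  obtain ⟨et, ret⟩ : ∃ et : XX, et = (1, 0) := ⟨_, rfl⟩
  obtain ⟨e0, re0⟩ : ∃ e0 : XX, e0 = (0, Pi.single 0 1) := ⟨_, rfl⟩
  obtain ⟨e1, re1⟩ : ∃ e1 : XX, e1 = (0, Pi.single 1 1) := ⟨_, rfl⟩
  have pd0 : ∀ (F : XX → ℝ) (_ : ContDiff ℝ (⊤ : ℕ∞) F) (t : ℝ) (x : Fin 2 → ℝ),
      pd 0 (fun y => F (t, y)) x = DD e0 F (t, x) := by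
    intro F hF t x; rw [pd_eq 0 F hF t x, re0]
  have pd1 : ∀ (F : XX → ℝ) (_ : ContDiff ℝ (⊤ : ℕ∞) F) (t : ℝ) (x : Fin 2 → ℝ),
      pd 1 (fun y => F (t, y)) x = DD e1 F (t, x) := by
    intro F hF t x; rw [pd_eq 1 F hF t x, re1]
  have dtt : ∀ (F : XX → ℝ) (_ : ContDiff ℝ (⊤ : ℕ∞) F) (t : ℝ) (x : Fin 2 → ℝ),
      deriv (fun s => F (s, x)) t = DD et F (t, x) := by
    intro F hF t x; rw [(dt_hasDeriv F hF t x).deriv, ret]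
  obtain ⟨e, he⟩ : ∃ e : XX → ℝ, e = fun q => (ρ / 2) * (U q ^ 2 + V q ^ 2) + lam *
      (γ1 * ((Ψ q - 1) / 2) ^ 2 *
      ((ε1 / 2) * (DD e0 Φ q ^ 2 + DD e1 Φ q ^ 2) + (1 / (4 * ε1)) * ((Φ q) ^ 2 - 1) ^ 2)
      + γ2 * ((ε2 / 2) * (DD e0 Ψ q ^ 2 + DD e1 Ψ q ^ 2)
        + (1 / (4 * ε2)) * ((Ψ q) ^ 2 - 1) ^ 2)) := ⟨_, rfl⟩
  obtain ⟨Eφ, rEφ⟩ : ∃ E : XX → ℝ, E = fun q =>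
      -γ1 * (ε1 * (DD e0 (fun q => ((Ψ q - 1) / 2) ^ 2 * DD e0 Φ q) q
        + DD e1 (fun q => ((Ψ q - 1) / 2) ^ 2 * DD e1 Φ q) q)
      - (1 / ε1) * ((Ψ q - 1) / 2) ^ 2 * ((Φ q) ^ 2 - 1) * Φ q) := ⟨_, rfl⟩
  obtain ⟨Eψ, rEψ⟩ : ∃ E : XX → ℝ, E = fun q =>
      -γ2 * (ε2 * (DD e0 (DD e0 Ψ) q + DD e1 (DD e1 Ψ) q)
        - (1 / ε2) * ((Ψ q) ^ 2 - 1) * Ψ q)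
      + γ1 * ((Ψ q - 1) / 2) *
      ((ε1 / 2) * (DD e0 Φ q ^ 2 + DD e1 Φ q ^ 2) + (1 / (4 * ε1)) * ((Φ q) ^ 2 - 1) ^ 2) :=
    ⟨_, rfl⟩
  have hes : ContDiff ℝ (⊤ : ℕ∞) e := by
    rw [he]; fun_prop
  have hdE1 : ∀ t x, dEdφ γ1 ε1 (φ t) (ψ t) x = Eφ (t, x) := by
    intro t x
    rw [rEφ]
    simp only [dEdφ, eΦ, eΨ, Fin.sum_univ_two, pd0 Φ sΦ, pd1 Φ sΦ]
    rw [pd0 (fun q => ((Ψ q - 1) / 2) ^ 2 * DD e0 Φ q) (by fun_prop),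
      pd1 (fun q => ((Ψ q - 1) / 2) ^ 2 * DD e1 Φ q) (by fun_prop)]
  have hdE2 : ∀ t x, dEdψ γ1 γ2 ε1 ε2 (φ t) (ψ t) x = Eψ (t, x) := by
    intro t x
    rw [rEψ]
    simp only [dEdψ, eΦ, eΨ, Fin.sum_univ_two, pd0 Φ sΦ, pd1 Φ sΦ, pd0 Ψ sΨ, pd1 Ψ sΨ]
    rw [pd0 (DD e0 Ψ) (by fun_prop), pd1 (DD e1 Ψ) (by fun_prop)]
  have hgoal : ∀ t x, (ρ / 2) * ∑ i, (u t x i) ^ 2 + lam * W γ1 γ2 ε1 ε2 (φ t) (ψ t) x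
      = e (t, x) := by
    intro t x
    rw [he]
    simp only [W, eΦ, eΨ, eU, eV, Fin.sum_univ_two, pd0 Φ sΦ, pd1 Φ sΦ, pd0 Ψ sΨ, pd1 Ψ sΨ]
  simp only [hgoal]
  have perD : ∀ (j : Fin 2) (v : XX) (F : XX → ℝ), (∀ q, F (q + (0, Pi.single j 1)) = F q) →
      ∀ q, DD v F (q + (0, Pi.single j 1)) = DD v F q := fun j v F h q => DD_per v _ F h q
  have pe : ∀ (j : Fin 2) q, e (q + (0, Pi.single j 1)) = e q := by
    intro j q
    rw [he]
    simp only [pU, pV, pΦ, pΨ, perD j _ Φ (pΦ j), perD j _ Ψ (pΨ j)]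
  refine mono_of_local T e
    (fun q => (-(lam * M1) * Eφ q ^ 2 - lam * M2 * Eψ q ^ 2
        - μ * (DD e0 U q ^ 2 + DD e1 U q ^ 2 + DD e0 V q ^ 2 + DD e1 V q ^ 2)))
    (fun q => lam * (γ1 * ε1 * ((Ψ q - 1) / 2) ^ 2 * DD e0 Φ q * DD et Φ q
            + γ2 * ε2 * DD e0 Ψ q * DD et Ψ q)
          - U q * (P q + e q) + μ * (U q * DD e0 U q + V q * DD e0 V q))
    (fun q => lam * (γ1 * ε1 * ((Ψ q - 1) / 2) ^ 2 * DD e1 Φ q * DD et Φ q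
            + γ2 * ε2 * DD e1 Ψ q * DD et Ψ q)
          - V q * (P q + e q) + μ * (U q * DD e1 U q + V q * DD e1 V q))
    hes (by fun_prop) (by fun_prop) ?_ ?_ ?_ ?_
  · intro q
    simp only [pU, pV, pP, pΦ, pΨ, pe, perD 0 _ Φ (pΦ 0), perD 0 _ Ψ (pΨ 0),
      perD 0 _ U (pU 0), perD 0 _ V (pV 0)]
  · intro q
    simp only [pU, pV, pP, pΦ, pΨ, pe, perD 1 _ Φ (pΦ 1), perD 1 _ Ψ (pΨ 1),
      perD 1 _ U (pU 1), perD 1 _ V (pV 1)]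
  · intro q
    have h1 : 0 ≤ (lam * M1) * Eφ q ^ 2 := by positivity
    have h2 : 0 ≤ lam * M2 * Eψ q ^ 2 := by positivity
    have h3 : 0 ≤ μ * (DD e0 U q ^ 2 + DD e1 U q ^ 2 + DD e0 V q ^ 2 + DD e1 V q ^ 2) := by
      positivity
    linarith
  · intro t ht x
    rw [← ret, ← re0, ← re1]
    have hm0 := hmom t ht x 0
    have hm1 := hmom t ht x 1
    have hd := hdiv t ht x
    have h1 := hφeq t ht x
    have h2 := hψeq t ht x
    rw [hdE1] at h1
    rw [hdE2] at h2
    simp only [sigmaE, eU, eV, eP, eΦ, eΨ, Fin.sum_univ_two, pd0 Φ sΦ, pd1 Φ sΦ, pd0 Ψ sΨ,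
      pd1 Ψ sΨ, pd0 U sU, pd1 U sU, pd0 V sV, pd1 V sV, pd0 P sP, pd1 P sP,
      dtt U sU, dtt V sV, dtt Φ sΦ, dtt Ψ sΨ] at hm0 hm1 hd h1 h2
    rw [pd0 (fun q => -(γ1 * ε1 * ((Ψ q - 1) / 2) ^ 2 * DD e0 Φ q * DD e0 Φ q)
            - γ2 * ε2 * DD e0 Ψ q * DD e0 Ψ q) (by fun_prop),
      pd1 (fun q => -(γ1 * ε1 * ((Ψ q - 1) / 2) ^ 2 * DD e0 Φ q * DD e1 Φ q)
            - γ2 * ε2 * DD e0 Ψ q * DD e1 Ψ q) (by fun_prop),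
      pd0 (DD e0 U) (by fun_prop), pd1 (DD e1 U) (by fun_prop)] at hm0
    rw [pd0 (fun q => -(γ1 * ε1 * ((Ψ q - 1) / 2) ^ 2 * DD e1 Φ q * DD e0 Φ q)
            - γ2 * ε2 * DD e1 Ψ q * DD e0 Ψ q) (by fun_prop),
      pd1 (fun q => -(γ1 * ε1 * ((Ψ q - 1) / 2) ^ 2 * DD e1 Φ q * DD e1 Φ q)
            - γ2 * ε2 * DD e1 Ψ q * DD e1 Ψ q) (by fun_prop),
      pd0 (DD e0 V) (by fun_prop), pd1 (DD e1 V) (by fun_prop)] at hm1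
    exact local_id ρ μ lam M1 M2 γ1 γ2 ε1 ε2 et e0 e1 (t, x) U V P Φ Ψ sU sV sP sΦ sΨ
      (Eφ (t, x)) (Eψ (t, x)) (by rw [rEφ]) (by rw [rEψ]) hm0 hm1 hd h1 h2 e he
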